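/- arXiv:2001.00936 — 3 statements merged into one kernel-verified Lean document; each statement's English description precedes it below -/
import Mathlib

section
/- TJK⁺ = TJK^{d+}: For any set Γ ∪ {φ} of L⁺-sentences, Γ ⊢_{TJK^{d+}} φ if and only if Γ ⊢_{TJK⁺} φ; i.e., the ∃-Elim rule is redundant in TJK^{d+}. -/
universe u v

namespace BQL

structure Signature : Type 1 where
  Const : Type
  Func : Type
  arityF : Func → ℕ
  Rel : Type
  arityR : Rel → ℕ

inductive Term (L : Signature) : Type
  | var : ℕ → Term L
  | const : L.Const → Term L
  | func : (f : L.Func) → (Fin (L.arityF f) → Term L) → Term L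

inductive Formula (L : Signature) : Type
  | top : Formula L
  | bot : Formula L
  | rel : (R : L.Rel) → (Fin (L.arityR R) → Term L) → Formula L
  | and : Formula L → Formula L → Formula L
  | or : Formula L → Formula L → Formula L
  | imp : Formula L → Formula L → Formula L
  | all : Formula L → Formula L
  | ex : Formula L → Formula L

variable {L : Signature}

namespace Term

/-- Shift all (free) variables of a term up by one. -/
def shiftUp : Term L → Term L
  | var n => var (n + 1)
  | const c => const c
  | func f ts => func f fun i => (ts i).shiftUp

/-- Apply a simultaneous substitution to a term. -/
def applySub (σ : ℕ → Term L) : Term L → Term L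
  | var n => σ n
  | const c => const c
  | func f ts => func f fun i => (ts i).applySub σ

/-- All variables of the term are `< k`. -/
def ClosedAt : Term L → ℕ → Prop
  | var n, k => n < k
  | const _, _ => True
  | func _ ts, k => ∀ i, (ts i).ClosedAt k

/-- A closed term. -/
def Closed (t : Term L) : Prop := t.ClosedAt 0

/-- The constant `c` occurs in the term. -/
def OccC (c : L.Const) : Term L → Prop
  | var _ => False
  | const d => d = c
  | func _ ts => ∃ i, (ts i).OccC c

end Term

/-- Lift a substitution under a binder. -/
def liftSub (σ : ℕ → Term L) : ℕ → Term L
  | 0 => .var 0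
  | n + 1 => (σ n).shiftUp

namespace Formula

/-- Apply a simultaneous substitution to a formula. -/
def applySub (σ : ℕ → Term L) : Formula L → Formula L
  | top => top
  | bot => bot
  | rel R ts => rel R fun i => (ts i).applySub σ
  | and φ ψ => and (φ.applySub σ) (ψ.applySub σ)
  | or φ ψ => or (φ.applySub σ) (ψ.applySub σ)
  | imp φ ψ => imp (φ.applySub σ) (ψ.applySub σ)
  | all φ => all (φ.applySub (liftSub σ))
  | ex φ => ex (φ.applySub (liftSub σ))

/-- All free variables of the formula are `< k`. -/
def ClosedAt : Formula L → ℕ → Prop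
  | top, _ => True
  | bot, _ => True
  | rel _ ts, k => ∀ i, (ts i).ClosedAt k
  | and φ ψ, k => φ.ClosedAt k ∧ ψ.ClosedAt k
  | or φ ψ, k => φ.ClosedAt k ∧ ψ.ClosedAt k
  | imp φ ψ, k => φ.ClosedAt k ∧ ψ.ClosedAt k
  | all φ, k => φ.ClosedAt (k + 1)
  | ex φ, k => φ.ClosedAt (k + 1)

/-- A sentence: a formula with no free variables. -/
def Sentence (φ : Formula L) : Prop := φ.ClosedAt 0

/-- The constant `c` occurs in the formula. -/
def OccC (c : L.Const) : Formula L → Prop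
  | top => False
  | bot => False
  | rel _ ts => ∃ i, (ts i).OccC c
  | and φ ψ => φ.OccC c ∨ ψ.OccC c
  | or φ ψ => φ.OccC c ∨ ψ.OccC c
  | imp φ ψ => φ.OccC c ∨ ψ.OccC c
  | all φ => φ.OccC c
  | ex φ => φ.OccC c

/-- The formula contains no occurrence of `∨` and no occurrence of `∃`. -/
def NoOrEx : Formula L → Prop
  | top => True
  | bot => True
  | rel _ _ => True
  | and φ ψ => φ.NoOrEx ∧ ψ.NoOrEx
  | or _ _ => False
  | imp φ ψ => φ.NoOrEx ∧ ψ.NoOrEx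
  | all φ => φ.NoOrEx
  | ex _ => False

end Formula

/-- Substitute the term `t` for the variable `v₀` (lowering the other variables). -/
def subst0 (φ : Formula L) (t : Term L) : Formula L :=
  φ.applySub fun n => match n with | 0 => t | n + 1 => .var n

/-- `□ⁿφ`, where `□φ` abbreviates `⊤ → φ`. -/
def boxN : ℕ → Formula L → Formula L
  | 0, φ => φ
  | n + 1, φ => .imp .top (boxN n φ)

/-- The conjunction of a finite list of formulas (`⋀∅ = ⊤`). -/
def conjL : List (Formula L) → Formula L
  | [] => .top
  | [φ] => φ
  | φ :: ψ :: l => .and φ (conjL (ψ :: l))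

/-- The language `L⁺`, obtained from `L` by adding countably many fresh constants `aᵢ`. -/
def Signature.plus (L : Signature) : Signature where
  Const := L.Const ⊕ ℕ
  Func := L.Func
  arityF := L.arityF
  Rel := L.Rel
  arityR := L.arityR

/-- The fresh constant `aᵢ` of `L⁺`. -/
def aconst (L : Signature) (i : ℕ) : Term L.plus := .const (Sum.inr i)

/-- Embedding of `L`-terms into `L⁺`-terms. -/
def Term.emb : Term L → Term L.plus
  | .var n => .var n
  | .const c => .const (Sum.inl c)
  | .func f ts => .func f fun i => (ts i).emb

/-- Embedding of `L`-formulas into `L⁺`-formulas. -/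
def Formula.emb : Formula L → Formula L.plus
  | .top => .top
  | .bot => .bot
  | .rel R ts => .rel R fun i => (ts i).emb
  | .and φ ψ => .and φ.emb ψ.emb
  | .or φ ψ => .or φ.emb ψ.emb
  | .imp φ ψ => .imp φ.emb ψ.emb
  | .all φ => .all φ.emb
  | .ex φ => .ex φ.emb

/-- The fresh constant `aᵢ` occurs in no member of `Γ`. -/
def FreshIn (i : ℕ) (Γ : Set (Formula L.plus)) : Prop :=
  ∀ ψ ∈ Γ, ¬ ψ.OccC (Sum.inr i)

/-- A Kripke `L`-model (the frame conditions are packaged in `KModel.Proper`). -/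
structure KModel (L : Signature) : Type (u + 1) where
  W : Type u
  acc : W → W → Prop
  D : Type u
  interpC : L.Const → D
  interpF : (f : L.Func) → (Fin (L.arityF f) → D) → D
  interpR : (R : L.Rel) → W → Set (Fin (L.arityR R) → D)

/-- The conditions on an `L`-model: nonempty set of worlds, transitive accessibility
relation, nonempty domain, and the persistence constraint. -/
def KModel.Proper (M : KModel.{u} L) : Prop :=
  Nonempty M.W ∧ Nonempty M.D ∧ Transitive M.acc ∧
    ∀ (R : L.Rel) (w u' : M.W), M.acc w u' → M.interpR R w ⊆ M.interpR R u'

/-- Prepend a value to a valuation. -/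
def vcons {α : Sort*} (d : α) (ρ : ℕ → α) : ℕ → α
  | 0 => d
  | n + 1 => ρ n

/-- Denotation of a term. -/
def Term.eval (M : KModel.{u} L) (ρ : ℕ → M.D) : Term L → M.D
  | .var n => ρ n
  | .const c => M.interpC c
  | .func f ts => M.interpF f fun i => (ts i).eval M ρ

/-- The satisfaction relation `w ⊩ φ(ā)`. -/
def Sat (M : KModel.{u} L) : M.W → (ℕ → M.D) → Formula L → Prop
  | _, _, .top => True
  | _, _, .bot => False
  | w, ρ, .rel R ts => (fun i => (ts i).eval M ρ) ∈ M.interpR R w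
  | w, ρ, .and φ ψ => Sat M w ρ φ ∧ Sat M w ρ ψ
  | w, ρ, .or φ ψ => Sat M w ρ φ ∨ Sat M w ρ ψ
  | w, ρ, .imp φ ψ => ∀ u', M.acc w u' → Sat M u' ρ φ → Sat M u' ρ ψ
  | w, ρ, .all φ => ∀ d, Sat M w (vcons d ρ) φ
  | w, ρ, .ex φ => ∃ d, Sat M w (vcons d ρ) φ

/-- Satisfaction of a sentence (under every valuation). -/
def SatS (M : KModel.{u} L) (w : M.W) (φ : Formula L) : Prop := ∀ ρ, Sat M w ρ φ

/-- `Γ ⊨ φ`: truth is preserved at every reflexive world of every `L`-model. -/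
def Models (Γ : Set (Formula L)) (φ : Formula L) : Prop :=
  ∀ M : KModel.{u} L, M.Proper → ∀ w : M.W, M.acc w w →
    (∀ ψ ∈ Γ, SatS M w ψ) → SatS M w φ

/-- `Γ : Δ ⊨ φ`: for every `L`-model, every reflexive world `w` and every world `u ≻ w`:
if `w ⊩ Γ` and `u ⊩ Δ` then `u ⊩ φ`. -/
def ModelsCtx (Γ Δ : Set (Formula L)) (φ : Formula L) : Prop :=
  ∀ M : KModel.{u} L, M.Proper → ∀ w u' : M.W, M.acc w w → M.acc w u' →
    (∀ ψ ∈ Γ, SatS M w ψ) → (∀ ψ ∈ Δ, SatS M u' ψ) → SatS M u' φ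

end BQL

namespace BQL

/-- The axiom schemas of the original axiomatization of `TJK^{d+}` (the axioms of
`B^{d+}` together with transitivity, weakening, prefixing and suffixing). -/
inductive TJKAx (L : Signature) : Formula L.plus → Prop
  | id {φ} : φ.Sentence → TJKAx L (.imp φ φ)
  | toTop {φ} : φ.Sentence → TJKAx L (.imp φ .top)
  | fromBot {φ} : φ.Sentence → TJKAx L (.imp .bot φ)
  | andComp {φ ψ χ} : φ.Sentence → ψ.Sentence → χ.Sentence →
      TJKAx L (.imp (.and (.imp χ φ) (.imp χ ψ)) (.imp χ (.and φ ψ)))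
  | andElimL {φ ψ} : φ.Sentence → ψ.Sentence → TJKAx L (.imp (.and φ ψ) φ)
  | andElimR {φ ψ} : φ.Sentence → ψ.Sentence → TJKAx L (.imp (.and φ ψ) ψ)
  | orIntroL {φ ψ} : φ.Sentence → ψ.Sentence → TJKAx L (.imp φ (.or φ ψ))
  | orIntroR {φ ψ} : φ.Sentence → ψ.Sentence → TJKAx L (.imp ψ (.or φ ψ))
  | orComp {φ ψ χ} : φ.Sentence → ψ.Sentence → χ.Sentence →
      TJKAx L (.imp (.and (.imp φ χ) (.imp ψ χ)) (.imp (.or φ ψ) χ))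
  | distrib {φ ψ χ} : φ.Sentence → ψ.Sentence → χ.Sentence →
      TJKAx L (.imp (.and φ (.or ψ χ)) (.or (.and φ ψ) (.and φ χ)))
  | allImp {φ ψ} : φ.Sentence → ψ.ClosedAt 1 →
      TJKAx L (.imp (.all (.imp φ ψ)) (.imp φ (.all ψ)))
  | allElim {φ} {t : Term L.plus} : φ.ClosedAt 1 → t.Closed →
      TJKAx L (.imp (.all φ) (subst0 φ t))
  | exIntro {φ} {t : Term L.plus} : φ.ClosedAt 1 → t.Closed →
      TJKAx L (.imp (subst0 φ t) (.ex φ))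
  | exImp {φ ψ} : φ.ClosedAt 1 → ψ.Sentence →
      TJKAx L (.imp (.all (.imp φ ψ)) (.imp (.ex φ) ψ))
  | cd {φ ψ} : φ.Sentence → ψ.ClosedAt 1 →
      TJKAx L (.imp (.all (.or φ ψ)) (.or φ (.all ψ)))
  | exDistrib {φ ψ} : φ.Sentence → ψ.ClosedAt 1 →
      TJKAx L (.imp (.and φ (.ex ψ)) (.ex (.and φ ψ)))
  | trans {φ ψ χ} : φ.Sentence → ψ.Sentence → χ.Sentence →
      TJKAx L (.imp (.and (.imp φ ψ) (.imp ψ χ)) (.imp φ χ))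
  | weakK {φ ψ} : φ.Sentence → ψ.Sentence → TJKAx L (.imp φ (.imp ψ φ))
  | prefixing {φ ψ χ} : φ.Sentence → ψ.Sentence → χ.Sentence →
      TJKAx L (.imp (.imp φ ψ) (.imp (.imp χ φ) (.imp χ ψ)))
  | suffixing {φ ψ χ} : φ.Sentence → ψ.Sentence → χ.Sentence →
      TJKAx L (.imp (.imp φ ψ) (.imp (.imp ψ χ) (.imp φ χ)))

/-- `Γ ⊢_{TJK^{d+}} φ`: derivability in the original axiomatization of `TJK^{d+}`. -/
inductive TJKd (L : Signature) : Set (Formula L.plus) → Formula L.plus → Prop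
  | hyp {Γ φ} : φ ∈ Γ → φ.Sentence → TJKd L Γ φ
  | weaken {Γ Γ' φ} : Γ ⊆ Γ' → TJKd L Γ φ → TJKd L Γ' φ
  | ax {Γ φ} : TJKAx L φ → TJKd L Γ φ
  | topIntro {Γ} : TJKd L Γ .top
  | botElim {Γ φ} : φ.Sentence → TJKd L Γ .bot → TJKd L Γ φ
  | andIntro {Γ φ ψ} : TJKd L Γ φ → TJKd L Γ ψ → TJKd L Γ (.and φ ψ)
  | andElimL {Γ φ ψ} : TJKd L Γ (.and φ ψ) → TJKd L Γ φ
  | andElimR {Γ φ ψ} : TJKd L Γ (.and φ ψ) → TJKd L Γ ψ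
  | orIntroL {Γ φ ψ} : ψ.Sentence → TJKd L Γ φ → TJKd L Γ (.or φ ψ)
  | orIntroR {Γ φ ψ} : φ.Sentence → TJKd L Γ ψ → TJKd L Γ (.or φ ψ)
  | orElim {Γ φ ψ χ} : TJKd L Γ (.or φ ψ) → TJKd L (insert φ Γ) χ →
      TJKd L (insert ψ Γ) χ → TJKd L Γ χ
  | impElim {Γ φ ψ} : TJKd L Γ φ → TJKd L Γ (.imp φ ψ) → TJKd L Γ ψ
  | affix {Γ φ ψ χ γ} : TJKd L Γ (.imp φ ψ) → TJKd L Γ (.imp χ γ) →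
      TJKd L Γ (.imp (.imp ψ χ) (.imp φ γ))
  | allIntro {Γ Γ' φ} {i : ℕ} : Γ' ⊆ Γ → FreshIn i Γ' → ¬ φ.OccC (Sum.inr i) →
      TJKd L Γ' (subst0 φ (aconst L i)) → TJKd L Γ (.all φ)
  | allElim {Γ φ} {t : Term L.plus} : t.Closed → TJKd L Γ (.all φ) →
      TJKd L Γ (subst0 φ t)
  | cd {Γ φ ψ} : φ.Sentence → TJKd L Γ (.all (.or φ ψ)) → TJKd L Γ (.or φ (.all ψ))
  | exIntro {Γ φ} {t : Term L.plus} : t.Closed → (Formula.ex φ).Sentence →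
      TJKd L Γ (subst0 φ t) → TJKd L Γ (.ex φ)
  | exElim {Γ Γ' φ ψ} {i : ℕ} : Γ' ⊆ Γ → FreshIn i Γ' → ¬ φ.OccC (Sum.inr i) →
      ¬ ψ.OccC (Sum.inr i) → TJKd L Γ (.ex φ) →
      TJKd L (insert (subst0 φ (aconst L i)) Γ') ψ → TJKd L Γ ψ

/-- `Γ ⊢_{TJK⁺} φ`: derivability in `TJK⁺`, i.e. `TJK^{d+}` without the `∃`-Elim rule. -/
inductive TJKp (L : Signature) : Set (Formula L.plus) → Formula L.plus → Prop
  | hyp {Γ φ} : φ ∈ Γ → φ.Sentence → TJKp L Γ φ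
  | weaken {Γ Γ' φ} : Γ ⊆ Γ' → TJKp L Γ φ → TJKp L Γ' φ
  | ax {Γ φ} : TJKAx L φ → TJKp L Γ φ
  | topIntro {Γ} : TJKp L Γ .top
  | botElim {Γ φ} : φ.Sentence → TJKp L Γ .bot → TJKp L Γ φ
  | andIntro {Γ φ ψ} : TJKp L Γ φ → TJKp L Γ ψ → TJKp L Γ (.and φ ψ)
  | andElimL {Γ φ ψ} : TJKp L Γ (.and φ ψ) → TJKp L Γ φ
  | andElimR {Γ φ ψ} : TJKp L Γ (.and φ ψ) → TJKp L Γ ψ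
  | orIntroL {Γ φ ψ} : ψ.Sentence → TJKp L Γ φ → TJKp L Γ (.or φ ψ)
  | orIntroR {Γ φ ψ} : φ.Sentence → TJKp L Γ ψ → TJKp L Γ (.or φ ψ)
  | orElim {Γ φ ψ χ} : TJKp L Γ (.or φ ψ) → TJKp L (insert φ Γ) χ →
      TJKp L (insert ψ Γ) χ → TJKp L Γ χ
  | impElim {Γ φ ψ} : TJKp L Γ φ → TJKp L Γ (.imp φ ψ) → TJKp L Γ ψ
  | affix {Γ φ ψ χ γ} : TJKp L Γ (.imp φ ψ) → TJKp L Γ (.imp χ γ) →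
      TJKp L Γ (.imp (.imp ψ χ) (.imp φ γ))
  | allIntro {Γ Γ' φ} {i : ℕ} : Γ' ⊆ Γ → FreshIn i Γ' → ¬ φ.OccC (Sum.inr i) →
      TJKp L Γ' (subst0 φ (aconst L i)) → TJKp L Γ (.all φ)
  | allElim {Γ φ} {t : Term L.plus} : t.Closed → TJKp L Γ (.all φ) →
      TJKp L Γ (subst0 φ t)
  | cd {Γ φ ψ} : φ.Sentence → TJKp L Γ (.all (.or φ ψ)) → TJKp L Γ (.or φ (.all ψ))
  | exIntro {Γ φ} {t : Term L.plus} : t.Closed → (Formula.ex φ).Sentence →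
      TJKp L Γ (subst0 φ t) → TJKp L Γ (.ex φ)

end BQL

namespace BQL

namespace Term

variable {L : Signature}

theorem closedAt_shiftUp {t : Term L} {k : ℕ} : t.shiftUp.ClosedAt (k + 1) ↔ t.ClosedAt k := by
  induction t with
  | var n => simp [shiftUp, ClosedAt]
  | const c => simp [shiftUp, ClosedAt]
  | func f ts ih => simp [shiftUp, ClosedAt, ih]

theorem ClosedAt.mono {t : Term L} {j k : ℕ} (ht : t.ClosedAt j) (hjk : j ≤ k) :
    t.ClosedAt k := by
  induction t with
  | var n => exact lt_of_lt_of_le ht hjk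
  | const c => trivial
  | func f ts ih => exact fun i => ih i (ht i)

theorem ClosedAt.applySub {t : Term L} {σ : ℕ → Term L} {j k : ℕ} (ht : t.ClosedAt j)
    (hσ : ∀ n < j, (σ n).ClosedAt k) : (t.applySub σ).ClosedAt k := by
  induction t with
  | var n => exact hσ n ht
  | const c => trivial
  | func f ts ih => exact fun i => ih i (ht i)

theorem ClosedAt.of_applySub {t : Term L} {σ : ℕ → Term L} {j k : ℕ}
    (ht : (t.applySub σ).ClosedAt k) (hσ : ∀ n, j ≤ n → ¬ (σ n).ClosedAt k) : t.ClosedAt j := by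
  induction t with
  | var n => exact not_le.1 fun h => hσ n h ht
  | const c => trivial
  | func f ts ih => exact fun i => ih i (ht i)

theorem ClosedAt.applySub_eq_self {t : Term L} {σ : ℕ → Term L} {j : ℕ} (ht : t.ClosedAt j)
    (hσ : ∀ n < j, σ n = .var n) : t.applySub σ = t := by
  induction t with
  | var n => exact hσ n ht
  | const c => rfl
  | func f ts ih => exact congrArg _ (funext fun i => ih i (ht i))

end Term

namespace Formula

variable {L : Signature}

theorem ClosedAt.mono {φ : Formula L} {j k : ℕ} (hφ : φ.ClosedAt j) (hjk : j ≤ k) :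
    φ.ClosedAt k := by
  induction φ generalizing j k with
  | top => trivial
  | bot => trivial
  | rel R ts => exact fun i => (hφ i).mono hjk
  | and φ ψ ih₁ ih₂ => exact ⟨ih₁ hφ.1 hjk, ih₂ hφ.2 hjk⟩
  | or φ ψ ih₁ ih₂ => exact ⟨ih₁ hφ.1 hjk, ih₂ hφ.2 hjk⟩
  | imp φ ψ ih₁ ih₂ => exact ⟨ih₁ hφ.1 hjk, ih₂ hφ.2 hjk⟩
  | all φ ih => exact ih (j := j + 1) hφ (Nat.succ_le_succ hjk)
  | ex φ ih => exact ih (j := j + 1) hφ (Nat.succ_le_succ hjk)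

theorem ClosedAt.applySub {φ : Formula L} {σ : ℕ → Term L} {j k : ℕ} (hφ : φ.ClosedAt j)
    (hσ : ∀ n < j, (σ n).ClosedAt k) : (φ.applySub σ).ClosedAt k := by
  have lift : ∀ {σ : ℕ → Term L} {j k : ℕ}, (∀ n < j, (σ n).ClosedAt k) →
      ∀ n < j + 1, (liftSub σ n).ClosedAt (k + 1) := by
    rintro σ j k h (_ | n) hn
    · exact Nat.succ_pos k
    · exact Term.closedAt_shiftUp.2 (h n (Nat.lt_of_succ_lt_succ hn))
  induction φ generalizing σ j k with
  | top => trivial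
  | bot => trivial
  | rel R ts => exact fun i => (hφ i).applySub hσ
  | and φ ψ ih₁ ih₂ => exact ⟨ih₁ hφ.1 hσ, ih₂ hφ.2 hσ⟩
  | or φ ψ ih₁ ih₂ => exact ⟨ih₁ hφ.1 hσ, ih₂ hφ.2 hσ⟩
  | imp φ ψ ih₁ ih₂ => exact ⟨ih₁ hφ.1 hσ, ih₂ hφ.2 hσ⟩
  | all φ ih => exact ih (j := j + 1) (k := k + 1) hφ (lift hσ)
  | ex φ ih => exact ih (j := j + 1) (k := k + 1) hφ (lift hσ)

theorem ClosedAt.of_applySub {φ : Formula L} {σ : ℕ → Term L} {j k : ℕ}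
    (hφ : (φ.applySub σ).ClosedAt k) (hσ : ∀ n, j ≤ n → ¬ (σ n).ClosedAt k) : φ.ClosedAt j := by
  have lift : ∀ {σ : ℕ → Term L} {j k : ℕ}, (∀ n, j ≤ n → ¬ (σ n).ClosedAt k) →
      ∀ n, j + 1 ≤ n → ¬ (liftSub σ n).ClosedAt (k + 1) := by
    rintro σ j k h (_ | n) hn
    · exact absurd hn (Nat.not_succ_le_zero j)
    · exact fun hc => h n (Nat.le_of_succ_le_succ hn) (Term.closedAt_shiftUp.1 hc)
  induction φ generalizing σ j k with
  | top => trivial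
  | bot => trivial
  | rel R ts => exact fun i => (hφ i).of_applySub hσ
  | and φ ψ ih₁ ih₂ => exact ⟨ih₁ hφ.1 hσ, ih₂ hφ.2 hσ⟩
  | or φ ψ ih₁ ih₂ => exact ⟨ih₁ hφ.1 hσ, ih₂ hφ.2 hσ⟩
  | imp φ ψ ih₁ ih₂ => exact ⟨ih₁ hφ.1 hσ, ih₂ hφ.2 hσ⟩
  | all φ ih => exact ih (j := j + 1) (k := k + 1) hφ (lift hσ)
  | ex φ ih => exact ih (j := j + 1) (k := k + 1) hφ (lift hσ)

theorem ClosedAt.applySub_eq_self {φ : Formula L} {σ : ℕ → Term L} {j : ℕ} (hφ : φ.ClosedAt j)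
    (hσ : ∀ n < j, σ n = .var n) : φ.applySub σ = φ := by
  have lift : ∀ {σ : ℕ → Term L} {j : ℕ}, (∀ n < j, σ n = .var n) →
      ∀ n < j + 1, liftSub σ n = .var n := by
    rintro σ j h (_ | n) hn
    · rfl
    · simp [liftSub, h n (Nat.lt_of_succ_lt_succ hn), Term.shiftUp]
  induction φ generalizing σ j with
  | top => rfl
  | bot => rfl
  | rel R ts => exact congrArg _ (funext fun i => (hφ i).applySub_eq_self hσ)
  | and φ ψ ih₁ ih₂ => exact congrArg₂ _ (ih₁ hφ.1 hσ) (ih₂ hφ.2 hσ)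
  | or φ ψ ih₁ ih₂ => exact congrArg₂ _ (ih₁ hφ.1 hσ) (ih₂ hφ.2 hσ)
  | imp φ ψ ih₁ ih₂ => exact congrArg₂ _ (ih₁ hφ.1 hσ) (ih₂ hφ.2 hσ)
  | all φ ih => exact congrArg _ (ih (j := j + 1) hφ (lift hσ))
  | ex φ ih => exact congrArg _ (ih (j := j + 1) hφ (lift hσ))

theorem Sentence.subst0_eq_self {φ : Formula L} (hφ : φ.Sentence) (t : Term L) :
    subst0 φ t = φ :=
  hφ.applySub_eq_self fun n hn => absurd hn (Nat.not_lt_zero n)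

theorem ClosedAt.subst0 {φ : Formula L} {t : Term L} (hφ : φ.ClosedAt 1) (ht : t.Closed) :
    (subst0 φ t).Sentence :=
  hφ.applySub fun n hn => by
    obtain rfl := Nat.lt_one_iff.1 hn
    exact ht

theorem ClosedAt.of_subst0 {φ : Formula L} {t : Term L} (h : (BQL.subst0 φ t).Sentence) :
    φ.ClosedAt 1 :=
  h.of_applySub fun n hn => by
    obtain ⟨m, rfl⟩ := Nat.exists_eq_succ_of_ne_zero (Nat.one_le_iff_ne_zero.1 hn)
    exact Nat.not_lt_zero m

theorem closedAt_boxN {n k : ℕ} {φ : Formula L} : (boxN n φ).ClosedAt k ↔ φ.ClosedAt k := by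
  induction n with
  | zero => rfl
  | succ n ih => simp [boxN, ClosedAt, ih]

theorem occC_boxN {n : ℕ} {c : L.Const} {φ : Formula L} : (boxN n φ).OccC c ↔ φ.OccC c := by
  induction n with
  | zero => rfl
  | succ n ih => simp [boxN, OccC, ih]

theorem subst0_boxN (n : ℕ) (φ : Formula L) (t : Term L) :
    subst0 (boxN n φ) t = boxN n (subst0 φ t) := by
  induction n with
  | zero => rfl
  | succ n ih => exact congrArg (imp top) ih

theorem boxN_add (m n : ℕ) (φ : Formula L) : boxN (m + n) φ = boxN m (boxN n φ) := by
  induction m with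
  | zero => rw [Nat.zero_add]; rfl
  | succ m ih => rw [Nat.succ_add]; exact congrArg (imp top) ih

/-- The conjunction of a list, nested to the left and starting from `⊤`. -/
def conjTop : List (Formula L) → Formula L
  | [] => top
  | φ :: l => and (conjTop l) φ

theorem sentence_conjTop {l : List (Formula L)} (h : ∀ φ ∈ l, φ.Sentence) :
    (conjTop l).Sentence := by
  induction l with
  | nil => trivial
  | cons φ l ih =>
    exact ⟨ih fun ψ hψ => h ψ (List.mem_cons_of_mem _ hψ), h φ List.mem_cons_self⟩

theorem not_occC_conjTop {c : L.Const} {l : List (Formula L)} (h : ∀ φ ∈ l, ¬ φ.OccC c) :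
    ¬ (conjTop l).OccC c := by
  induction l with
  | nil => exact id
  | cons φ l ih =>
    exact not_or.2 ⟨ih fun ψ hψ => h ψ (List.mem_cons_of_mem _ hψ), h φ List.mem_cons_self⟩

end Formula

open Formula

variable {L : Signature}

theorem TJKAx.sentence {φ : Formula L.plus} (h : TJKAx L φ) : φ.Sentence := by
  cases h with
  | allElim hφ ht => exact ⟨hφ, hφ.subst0 ht⟩
  | exIntro hφ ht => exact ⟨hφ.subst0 ht, hφ⟩
  | allImp hφ hψ => exact ⟨⟨hφ.mono (Nat.zero_le 1), hψ⟩, hφ, hψ⟩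
  | exImp hφ hψ => exact ⟨⟨hφ, hψ.mono (Nat.zero_le 1)⟩, hφ, hψ⟩
  | cd hφ hψ => exact ⟨⟨hφ.mono (Nat.zero_le 1), hψ⟩, hφ, hψ⟩
  | exDistrib hφ hψ => exact ⟨⟨hφ, hψ⟩, hφ.mono (Nat.zero_le 1), hψ⟩
  | _ => simp_all [Sentence, ClosedAt]

namespace TJKp

variable {Γ : Set (Formula L.plus)} {φ ψ χ δ : Formula L.plus}

theorem sentence (h : TJKp L Γ φ) : φ.Sentence := by
  induction h with
  | hyp _ hφ => exact hφ
  | weaken _ _ ih => exact ih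
  | ax h => exact h.sentence
  | topIntro => trivial
  | botElim hφ _ _ => exact hφ
  | andIntro _ _ ih₁ ih₂ => exact ⟨ih₁, ih₂⟩
  | andElimL _ ih => exact ih.1
  | andElimR _ ih => exact ih.2
  | orIntroL hψ _ ih => exact ⟨ih, hψ⟩
  | orIntroR hφ _ ih => exact ⟨hφ, ih⟩
  | orElim _ _ _ _ ih _ => exact ih
  | impElim _ _ _ ih => exact ih.2
  | affix _ _ ih₁ ih₂ => exact ⟨⟨ih₁.2, ih₂.1⟩, ih₁.1, ih₂.2⟩
  | allIntro _ _ _ _ ih => exact ClosedAt.of_subst0 ih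
  | allElim ht _ ih => exact ClosedAt.subst0 ih ht
  | cd hφ _ ih => exact ⟨hφ, ih.2⟩
  | exIntro _ h _ _ => exact h

theorem impTrans (h₁ : TJKp L Γ (.imp φ ψ)) (h₂ : TJKp L Γ (.imp ψ χ)) :
    TJKp L Γ (.imp φ χ) :=
  impElim (andIntro h₁ h₂) (ax (.trans h₁.sentence.1 h₁.sentence.2 h₂.sentence.2))

theorem impConst (hδ : δ.Sentence) (h : TJKp L Γ φ) : TJKp L Γ (.imp δ φ) :=
  impElim h (ax (.weakK h.sentence hδ))

theorem impAnd (h₁ : TJKp L Γ (.imp δ φ)) (h₂ : TJKp L Γ (.imp δ ψ)) :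
    TJKp L Γ (.imp δ (.and φ ψ)) :=
  impElim (andIntro h₁ h₂) (ax (.andComp h₁.sentence.2 h₂.sentence.2 h₁.sentence.1))

theorem impAndElimL (hφ : φ.Sentence) (hψ : ψ.Sentence) : TJKp L Γ (.imp (.and φ ψ) φ) :=
  ax (.andElimL hφ hψ)

theorem impAndElimR (hφ : φ.Sentence) (hψ : ψ.Sentence) : TJKp L Γ (.imp (.and φ ψ) ψ) :=
  ax (.andElimR hφ hψ)

theorem boxN_mono (n : ℕ) (h : TJKp L Γ (.imp φ ψ)) :
    TJKp L Γ (.imp (boxN n φ) (boxN n ψ)) := by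
  induction n with
  | zero => exact h
  | succ n ih => exact impElim ih (ax (.prefixing ih.sentence.1 ih.sentence.2 trivial))

theorem imp_boxN (n : ℕ) (hφ : φ.Sentence) : TJKp L Γ (.imp φ (boxN n φ)) := by
  induction n with
  | zero => exact ax (.id hφ)
  | succ n ih => exact impTrans ih (ax (.weakK ih.sentence.2 trivial))

theorem boxN_elim (n : ℕ) (h : TJKp L Γ (boxN n φ)) : TJKp L Γ φ := by
  induction n with
  | zero => exact h
  | succ n ih => exact ih (impElim topIntro h)

theorem boxN_and (n : ℕ) (hφ : φ.Sentence) (hψ : ψ.Sentence) :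
    TJKp L Γ (.imp (.and (boxN n φ) (boxN n ψ)) (boxN n (.and φ ψ))) := by
  induction n with
  | zero => exact ax (.id ⟨hφ, hψ⟩)
  | succ n ih =>
    exact impTrans (ax (.andComp ih.sentence.1.1 ih.sentence.1.2 trivial))
      (impElim ih (ax (.prefixing ih.sentence.1 ih.sentence.2 trivial)))

theorem all_boxN (n : ℕ) (hφ : φ.ClosedAt 1) :
    TJKp L Γ (.imp (.all (boxN n φ)) (boxN n (.all φ))) := by
  induction n with
  | zero => exact ax (.id hφ)
  | succ n ih =>
    exact impTrans (ax (.allImp (φ := .top) trivial (closedAt_boxN.2 hφ)))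
      (impElim ih (ax (.prefixing ih.sentence.1 ih.sentence.2 trivial)))

theorem imp_boxN_mp (hφ : φ.Sentence) (hψ : ψ.Sentence) :
    TJKp L Γ (.imp (.and φ (.imp φ ψ)) (boxN 1 ψ)) := by
  have hs : (Formula.imp φ ψ).Sentence := ⟨hφ, hψ⟩
  exact impTrans
    (impAnd (impTrans (impAndElimL hφ hs) (ax (.weakK (ψ := .top) hφ trivial)))
      (impAndElimR hφ hs))
    (ax (.trans trivial hφ hψ))

theorem imp_affix {γ : Formula L.plus} (hφ : φ.Sentence) (hψ : ψ.Sentence) (hχ : χ.Sentence)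
    (hγ : γ.Sentence) :
    TJKp L Γ (.imp (.and (.imp φ ψ) (.imp χ γ)) (.imp (.imp ψ χ) (.imp φ γ))) :=
  impTrans
    (impAnd
      (impTrans (impAndElimL ⟨hφ, hψ⟩ ⟨hχ, hγ⟩) (ax (.suffixing hφ hψ hχ)))
      (impTrans (impAndElimR ⟨hφ, hψ⟩ ⟨hχ, hγ⟩) (ax (.prefixing hχ hγ hφ))))
    (ax (.trans ⟨hψ, hχ⟩ ⟨hφ, hχ⟩ ⟨hφ, hγ⟩))

theorem conjTop_imp_of_mem {Δ : List (Formula L.plus)} (hΔ : ∀ ψ ∈ Δ, ψ.Sentence)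
    (h : φ ∈ Δ) : TJKp L Γ (.imp (conjTop Δ) φ) := by
  induction Δ with
  | nil => simp at h
  | cons ψ Δ ih =>
    have hs : ∀ ψ ∈ Δ, ψ.Sentence := fun χ hχ => hΔ χ (List.mem_cons_of_mem _ hχ)
    rcases List.mem_cons.1 h with rfl | h
    · exact impAndElimR (sentence_conjTop hs) (hΔ _ List.mem_cons_self)
    · exact impTrans (impAndElimL (sentence_conjTop hs) (hΔ _ List.mem_cons_self)) (ih hs h)

theorem conjTop_imp_conjTop {Δ Δ' : List (Formula L.plus)} (hΔ : ∀ ψ ∈ Δ, ψ.Sentence)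
    (h : Δ' ⊆ Δ) : TJKp L Γ (.imp (conjTop Δ) (conjTop Δ')) := by
  induction Δ' with
  | nil => exact ax (.toTop (sentence_conjTop hΔ))
  | cons ψ Δ' ih =>
    exact impAnd (ih fun χ hχ => h (List.mem_cons_of_mem _ hχ))
      (conjTop_imp_of_mem hΔ (h List.mem_cons_self))

theorem imp_boxN_and (hδ : ∃ n, TJKp L Γ (.imp δ (boxN n φ)))
    (hδ' : ∃ n, TJKp L Γ (.imp δ (boxN n ψ))) :
    ∃ n, TJKp L Γ (.imp δ (boxN n (.and φ ψ))) := by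
  obtain ⟨m, hm⟩ := hδ
  obtain ⟨n, hn⟩ := hδ'
  have hφ : φ.Sentence := closedAt_boxN.1 hm.sentence.2
  have hψ : ψ.Sentence := closedAt_boxN.1 hn.sentence.2
  refine ⟨m + n, impTrans (impAnd ?_ ?_) (boxN_and (m + n) hφ hψ)⟩
  · rw [boxN_add]
    exact impTrans hm (boxN_mono m (imp_boxN n hφ))
  · rw [Nat.add_comm, boxN_add]
    exact impTrans hn (boxN_mono n (imp_boxN m hψ))

theorem imp_boxN_bind {m : ℕ} (hδ : ∃ n, TJKp L Γ (.imp δ (boxN n φ)))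
    (h : TJKp L Γ (.imp φ (boxN m ψ))) : ∃ n, TJKp L Γ (.imp δ (boxN n ψ)) := by
  obtain ⟨n, hn⟩ := hδ
  exact ⟨n + m, by rw [boxN_add]; exact impTrans hn (boxN_mono n h)⟩

theorem imp_boxN_map (hδ : ∃ n, TJKp L Γ (.imp δ (boxN n φ)))
    (h : TJKp L Γ (.imp φ ψ)) : ∃ n, TJKp L Γ (.imp δ (boxN n ψ)) :=
  imp_boxN_bind (m := 0) hδ h

/-- The deduction theorem for `TJK⁺`: discharging finitely many hypotheses costs a power
of `□`. -/
theorem deduction {S : Set (Formula L.plus)} (h : TJKp L S φ) (Γ : Set (Formula L.plus))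
    (Δ : List (Formula L.plus)) (hΔ : ∀ ψ ∈ Δ, ψ.Sentence) (hS : ∀ ψ ∈ S, ψ ∈ Γ ∨ ψ ∈ Δ) :
    ∃ n, TJKp L Γ (.imp (conjTop Δ) (boxN n φ)) := by
  classical
  induction h generalizing Γ Δ with
  | hyp hmem hφ =>
    rcases hS _ hmem with hm | hm
    · exact ⟨0, impConst (sentence_conjTop hΔ) (hyp hm hφ)⟩
    · exact ⟨0, conjTop_imp_of_mem hΔ hm⟩
  | weaken hsub _ ih => exact ih Γ Δ hΔ fun ψ hψ => hS ψ (hsub hψ)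
  | ax h => exact ⟨0, impConst (sentence_conjTop hΔ) (ax h)⟩
  | topIntro => exact ⟨0, impConst (sentence_conjTop hΔ) topIntro⟩
  | botElim hφ _ ih => exact imp_boxN_map (ih Γ Δ hΔ hS) (ax (.fromBot hφ))
  | andIntro _ _ ih₁ ih₂ => exact imp_boxN_and (ih₁ Γ Δ hΔ hS) (ih₂ Γ Δ hΔ hS)
  | andElimL h ih =>
    exact imp_boxN_map (ih Γ Δ hΔ hS) (impAndElimL h.sentence.1 h.sentence.2)
  | andElimR h ih =>
    exact imp_boxN_map (ih Γ Δ hΔ hS) (impAndElimR h.sentence.1 h.sentence.2)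
  | orIntroL hψ h ih => exact imp_boxN_map (ih Γ Δ hΔ hS) (ax (.orIntroL h.sentence hψ))
  | orIntroR hφ h ih => exact imp_boxN_map (ih Γ Δ hΔ hS) (ax (.orIntroR hφ h.sentence))
  | @orElim S α β γ h _ _ ih ih₁ ih₂ =>
    have hδ := sentence_conjTop hΔ
    have hα : α.Sentence := h.sentence.1
    have hβ : β.Sentence := h.sentence.2
    have extend : ∀ {ξ : Formula L.plus}, ξ.Sentence →
        (∀ ψ ∈ ξ :: Δ, ψ.Sentence) ∧ ∀ ψ ∈ insert ξ S, ψ ∈ Γ ∨ ψ ∈ ξ :: Δ := by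
      refine fun hξ => ⟨List.forall_mem_cons.2 ⟨hξ, hΔ⟩, ?_⟩
      rintro ψ (rfl | hψ)
      · exact .inr List.mem_cons_self
      · exact (hS ψ hψ).imp_right (List.mem_cons_of_mem _)
    obtain ⟨m, hm⟩ := ih₁ Γ (α :: Δ) (extend hα).1 (extend hα).2
    obtain ⟨n, hn⟩ := ih₂ Γ (β :: Δ) (extend hβ).1 (extend hβ).2
    have hγ : γ.Sentence := closedAt_boxN.1 hm.sentence.2
    have hm' : TJKp L Γ (.imp (.and (conjTop Δ) α) (boxN (m + n) γ)) := by
      rw [boxN_add]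
      exact impTrans hm (boxN_mono m (imp_boxN n hγ))
    have hn' : TJKp L Γ (.imp (.and (conjTop Δ) β) (boxN (m + n) γ)) := by
      rw [Nat.add_comm, boxN_add]
      exact impTrans hn (boxN_mono n (imp_boxN m hγ))
    exact imp_boxN_bind (imp_boxN_and ⟨0, ax (.id hδ)⟩ (ih Γ Δ hΔ hS))
      (impTrans (ax (.distrib hδ hα hβ))
        (impElim (andIntro hm' hn')
          (ax (.orComp hm'.sentence.1 hn'.sentence.1 hm'.sentence.2))))
  | impElim _ h ih₁ ih₂ =>
    exact imp_boxN_bind (imp_boxN_and (ih₁ Γ Δ hΔ hS) (ih₂ Γ Δ hΔ hS))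
      (imp_boxN_mp h.sentence.1 h.sentence.2)
  | affix h₁ h₂ ih₁ ih₂ =>
    exact imp_boxN_map (imp_boxN_and (ih₁ Γ Δ hΔ hS) (ih₂ Γ Δ hΔ hS))
      (imp_affix h₁.sentence.1 h₁.sentence.2 h₂.sentence.1 h₂.sentence.2)
  | @allIntro S S' ψ i hsub hfresh hocc h ih =>
    have hψ : ψ.ClosedAt 1 := ClosedAt.of_subst0 h.sentence
    set Δ' := Δ.filter (· ∈ S') with hΔ'
    have hΔs : ∀ χ ∈ Δ', χ.Sentence := fun χ hχ => hΔ χ (List.mem_filter.1 hχ).1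
    have hδ := sentence_conjTop hΔs
    obtain ⟨n, hn⟩ := ih (Γ ∩ S') Δ' hΔs fun χ hχ =>
      (hS χ (hsub hχ)).imp (fun hc => ⟨hc, hχ⟩) fun hc => by simp [hΔ', hc, hχ]
    have hall : TJKp L Γ (.all (.imp (conjTop Δ') (boxN n ψ))) := by
      refine allIntro (i := i) Set.inter_subset_left (fun χ hχ => hfresh χ hχ.2) ?_ ?_
      · refine not_or.2 ⟨not_occC_conjTop fun χ hχ => hfresh χ ?_, mt occC_boxN.1 hocc⟩
        simpa using (List.mem_filter.1 hχ).2
      · have e : subst0 (.imp (conjTop Δ') (boxN n ψ)) (aconst L i) =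
            .imp (subst0 (conjTop Δ') (aconst L i)) (subst0 (boxN n ψ) (aconst L i)) := rfl
        rw [e, hδ.subst0_eq_self, subst0_boxN]
        exact hn
    exact ⟨n, impTrans (conjTop_imp_conjTop hΔ (List.filter_subset_self _))
      (impTrans (impElim hall (ax (.allImp hδ (closedAt_boxN.2 hψ)))) (all_boxN n hψ))⟩
  | allElim ht h ih => exact imp_boxN_map (ih Γ Δ hΔ hS) (ax (.allElim h.sentence ht))
  | cd hφ h ih => exact imp_boxN_map (ih Γ Δ hΔ hS) (ax (.cd hφ h.sentence.2))
  | exIntro ht hs _ ih => exact imp_boxN_map (ih Γ Δ hΔ hS) (ax (.exIntro hs ht))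

/-- The rule `∃`-Elim is admissible in `TJK⁺`. -/
theorem exElim {Γ' : Set (Formula L.plus)} {i : ℕ} (hsub : Γ' ⊆ Γ) (hfresh : FreshIn i Γ')
    (hφ : ¬ φ.OccC (Sum.inr i)) (hψ : ¬ ψ.OccC (Sum.inr i)) (hex : TJKp L Γ (.ex φ))
    (h : TJKp L (insert (subst0 φ (aconst L i)) Γ') ψ) : TJKp L Γ ψ := by
  have hφc : φ.ClosedAt 1 := hex.sentence
  have hinst : (subst0 φ (aconst L i)).Sentence := hφc.subst0 trivial
  obtain ⟨n, hn⟩ := h.deduction Γ' [subst0 φ (aconst L i)] (by simpa using hinst) (by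
    rintro χ (rfl | hχ)
    · exact .inr List.mem_cons_self
    · exact .inl hχ)
  have himp : TJKp L Γ' (.imp (subst0 φ (aconst L i)) (boxN n ψ)) :=
    impTrans (impAnd (ax (.toTop hinst)) (ax (.id hinst))) hn
  have hbox : (boxN n ψ).Sentence := himp.sentence.2
  have hall : TJKp L Γ (.all (.imp φ (boxN n ψ))) := by
    refine allIntro hsub hfresh (not_or.2 ⟨hφ, mt occC_boxN.1 hψ⟩) ?_
    have e : subst0 (.imp φ (boxN n ψ)) (aconst L i) =
        .imp (subst0 φ (aconst L i)) (subst0 (boxN n ψ) (aconst L i)) := rfl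
    rw [e, hbox.subst0_eq_self]
    exact himp
  exact boxN_elim n (impElim hex (impElim hall (ax (.exImp hφc hbox))))

theorem toTJKd (h : TJKp L Γ φ) : TJKd L Γ φ := by
  induction h with
  | hyp h₁ h₂ => exact .hyp h₁ h₂
  | weaken h₁ _ ih => exact .weaken h₁ ih
  | ax h => exact .ax h
  | topIntro => exact .topIntro
  | botElim h _ ih => exact .botElim h ih
  | andIntro _ _ ih₁ ih₂ => exact .andIntro ih₁ ih₂
  | andElimL _ ih => exact .andElimL ih
  | andElimR _ ih => exact .andElimR ih
  | orIntroL h _ ih => exact .orIntroL h ih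
  | orIntroR h _ ih => exact .orIntroR h ih
  | orElim _ _ _ ih ih₁ ih₂ => exact .orElim ih ih₁ ih₂
  | impElim _ _ ih₁ ih₂ => exact .impElim ih₁ ih₂
  | affix _ _ ih₁ ih₂ => exact .affix ih₁ ih₂
  | allIntro h₁ h₂ h₃ _ ih => exact .allIntro h₁ h₂ h₃ ih
  | allElim h _ ih => exact .allElim h ih
  | cd h _ ih => exact .cd h ih
  | exIntro h₁ h₂ _ ih => exact .exIntro h₁ h₂ ih

end TJKp

theorem TJKd.toTJKp {Γ : Set (Formula L.plus)} {φ : Formula L.plus} (h : TJKd L Γ φ) :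
    TJKp L Γ φ := by
  induction h with
  | hyp h₁ h₂ => exact .hyp h₁ h₂
  | weaken h₁ _ ih => exact .weaken h₁ ih
  | ax h => exact .ax h
  | topIntro => exact .topIntro
  | botElim h _ ih => exact .botElim h ih
  | andIntro _ _ ih₁ ih₂ => exact .andIntro ih₁ ih₂
  | andElimL _ ih => exact .andElimL ih
  | andElimR _ ih => exact .andElimR ih
  | orIntroL h _ ih => exact .orIntroL h ih
  | orIntroR h _ ih => exact .orIntroR h ih
  | orElim _ _ _ ih ih₁ ih₂ => exact .orElim ih ih₁ ih₂
  | impElim _ _ ih₁ ih₂ => exact .impElim ih₁ ih₂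
  | affix _ _ ih₁ ih₂ => exact .affix ih₁ ih₂
  | allIntro h₁ h₂ h₃ _ ih => exact .allIntro h₁ h₂ h₃ ih
  | allElim h _ ih => exact .allElim h ih
  | cd h _ ih => exact .cd h ih
  | exIntro h₁ h₂ _ ih => exact .exIntro h₁ h₂ ih
  | exElim h₁ h₂ h₃ h₄ _ _ ih₁ ih₂ => exact .exElim h₁ h₂ h₃ h₄ ih₁ ih₂

end BQL

namespace BQL

/-- **Proposition** (`TJK⁺ = TJK^{d+}`): `Γ ⊢_{TJK^{d+}} φ` iff `Γ ⊢_{TJK⁺} φ`,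
i.e. the `∃`-Elim rule is redundant in `TJK^{d+}`. -/
theorem tjkd_eq_tjkp {L : Signature} (Γ : Set (Formula L.plus)) (φ : Formula L.plus)
    (hΓ : ∀ ψ ∈ Γ, Formula.Sentence ψ) (hφ : φ.Sentence) :
    TJKd L Γ φ ↔ TJKp L Γ φ := by
  exact ⟨TJKd.toTJKp, TJKp.toTJKd⟩

end BQL
end

section
/- Generalized Soundness: If Γ : Σ ⊢ φ (i.e., there is a proof of φ from Γ ∪ Σ in NBQL_CD^r in which every open assumption that occurs unsafely belongs to Γ), then Γ : Σ ⊨ φ (i.e., for every L-model, every reflexive world w and every world u with w ≺ u: if w ⊩ Γ and u ⊩ Σ, then u ⊩ φ). -/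
universe u v

namespace BQL

/-- `Prf L Γ Δ φ` formalizes `Γ : Δ ⊢ φ`: there is a proof of `φ` in the natural
deduction system `NBQL_CD^r` (over `L⁺`-sentences) whose open assumptions all belong
to `Γ ∪ Δ` and in which every open assumption occurring *unsafely* (i.e. in the right
main subproof of an application of `→`-Elim) belongs to `Γ`.  Assumptions may be
discharged only at safe occurrences, so discharge always happens in the `Δ` zone. -/
inductive Prf (L : Signature) :
    Set (Formula L.plus) → Set (Formula L.plus) → Formula L.plus → Prop
  | hyp {Γ Δ : Set (Formula L.plus)} {φ} : φ ∈ Γ ∪ Δ → φ.Sentence → Prf L Γ Δ φ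
  | weaken {Γ Γ' Δ Δ' φ} : Γ ⊆ Γ' → Δ ⊆ Δ' → Prf L Γ Δ φ → Prf L Γ' Δ' φ
  | topIntro {Γ Δ} : Prf L Γ Δ .top
  | botElim {Γ Δ φ} : φ.Sentence → Prf L Γ Δ .bot → Prf L Γ Δ φ
  | andIntro {Γ Δ φ ψ} : Prf L Γ Δ φ → Prf L Γ Δ ψ → Prf L Γ Δ (.and φ ψ)
  | andElimL {Γ Δ φ ψ} : Prf L Γ Δ (.and φ ψ) → Prf L Γ Δ φ
  | andElimR {Γ Δ φ ψ} : Prf L Γ Δ (.and φ ψ) → Prf L Γ Δ ψ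
  | orIntroL {Γ Δ φ ψ} : ψ.Sentence → Prf L Γ Δ φ → Prf L Γ Δ (.or φ ψ)
  | orIntroR {Γ Δ φ ψ} : φ.Sentence → Prf L Γ Δ ψ → Prf L Γ Δ (.or φ ψ)
  | orElim {Γ Δ φ ψ χ} : Prf L Γ Δ (.or φ ψ) → Prf L Γ (insert φ Δ) χ →
      Prf L Γ (insert ψ Δ) χ → Prf L Γ Δ χ
  | impIntro {Γ Δ φ ψ} : φ.Sentence → Prf L Γ (insert φ Δ) ψ → Prf L Γ Δ (.imp φ ψ)
  | impElim {Γ Δ φ ψ} : Prf L Γ Δ φ → Prf L Γ ∅ (.imp φ ψ) → Prf L Γ Δ ψ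
  | intTrans {Γ Δ φ ψ χ} : Prf L Γ Δ (.imp φ ψ) → Prf L Γ Δ (.imp ψ χ) →
      Prf L Γ Δ (.imp φ χ)
  | intAndIntro {Γ Δ φ ψ χ} : Prf L Γ Δ (.imp φ ψ) → Prf L Γ Δ (.imp φ χ) →
      Prf L Γ Δ (.imp φ (.and ψ χ))
  | intOrElim {Γ Δ φ ψ χ} : Prf L Γ Δ (.imp φ χ) → Prf L Γ Δ (.imp ψ χ) →
      Prf L Γ Δ (.imp (.or φ ψ) χ)
  | intAllIntro {Γ Δ φ ψ} : φ.Sentence → Prf L Γ Δ (.all (.imp φ ψ)) →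
      Prf L Γ Δ (.imp φ (.all ψ))
  | intExElim {Γ Δ φ ψ} : ψ.Sentence → Prf L Γ Δ (.all (.imp φ ψ)) →
      Prf L Γ Δ (.imp (.ex φ) ψ)
  | allIntro {Γ Δ Γ' Δ' φ} {i : ℕ} : Γ' ⊆ Γ → Δ' ⊆ Δ → FreshIn i Γ' → FreshIn i Δ' →
      ¬ φ.OccC (Sum.inr i) → Prf L Γ' Δ' (subst0 φ (aconst L i)) → Prf L Γ Δ (.all φ)
  | allElim {Γ Δ φ} {t : Term L.plus} : t.Closed → Prf L Γ Δ (.all φ) →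
      Prf L Γ Δ (subst0 φ t)
  | cd {Γ Δ φ ψ} : φ.Sentence → Prf L Γ Δ (.all (.or φ ψ)) → Prf L Γ Δ (.or φ (.all ψ))
  | exIntro {Γ Δ φ} {t : Term L.plus} : t.Closed → (Formula.ex φ).Sentence →
      Prf L Γ Δ (subst0 φ t) → Prf L Γ Δ (.ex φ)
  | exElim {Γ Δ Γ' Δ' φ ψ} {i : ℕ} : Γ' ⊆ Γ → Δ' ⊆ Δ → FreshIn i Γ' → FreshIn i Δ' →
      ¬ φ.OccC (Sum.inr i) → ¬ ψ.OccC (Sum.inr i) → Prf L Γ Δ (.ex φ) →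
      Prf L Γ' (insert (subst0 φ (aconst L i)) Δ') ψ → Prf L Γ Δ ψ

/-- `Γ ⊢ φ`: there is a proof of `φ` from `Γ` in `NBQL_CD^r`. -/
def Prv (L : Signature) (Γ : Set (Formula L.plus)) (φ : Formula L.plus) : Prop :=
  Prf L Γ ∅ φ

end BQL

namespace BQL

variable {L : Signature}

theorem Term.eval_shiftUp (M : KModel.{u} L) (d : M.D) (ρ : ℕ → M.D) (t : Term L) :
    t.shiftUp.eval M (vcons d ρ) = t.eval M ρ := by
  induction t with
  | var n => rfl
  | const c => rfl
  | func f ts ih => simp only [Term.shiftUp, Term.eval, ih]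

theorem Term.eval_applySub (M : KModel.{u} L) (ρ : ℕ → M.D) (σ : ℕ → Term L) (t : Term L) :
    (t.applySub σ).eval M ρ = t.eval M fun n => (σ n).eval M ρ := by
  induction t with
  | var n => rfl
  | const c => rfl
  | func f ts ih => simp only [Term.applySub, Term.eval, ih]

theorem eval_liftSub (M : KModel.{u} L) (d : M.D) (ρ : ℕ → M.D) (σ : ℕ → Term L) :
    (fun n => (liftSub σ n).eval M (vcons d ρ)) = vcons d fun n => (σ n).eval M ρ := by
  funext n
  cases n with
  | zero => rfl
  | succ n => exact Term.eval_shiftUp M d ρ (σ n)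

theorem sat_applySub (M : KModel.{u} L) (φ : Formula L) (w : M.W) (ρ : ℕ → M.D)
    (σ : ℕ → Term L) :
    Sat M w ρ (φ.applySub σ) ↔ Sat M w (fun n => (σ n).eval M ρ) φ := by
  induction φ generalizing w ρ σ with
  | top => rfl
  | bot => rfl
  | rel R ts => simp only [Formula.applySub, Sat, Term.eval_applySub]
  | and φ ψ ihφ ihψ | or φ ψ ihφ ihψ | imp φ ψ ihφ ihψ =>
    simp only [Formula.applySub, Sat, ihφ, ihψ]
  | all φ ih | ex φ ih => simp only [Formula.applySub, Sat, ih, eval_liftSub]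

theorem sat_subst0 (M : KModel.{u} L) (φ : Formula L) (t : Term L) (w : M.W) (ρ : ℕ → M.D) :
    Sat M w ρ (subst0 φ t) ↔ Sat M w (vcons (t.eval M ρ) ρ) φ := by
  have h : (fun n => Term.eval M ρ (match n with | 0 => t | n + 1 => .var n)) =
      vcons (t.eval M ρ) ρ := by
    funext n
    cases n <;> rfl
  rw [subst0, sat_applySub, ← h]

theorem Term.eval_congr (M : KModel.{u} L) {t : Term L} {k : ℕ} (ht : t.ClosedAt k)
    {ρ ρ' : ℕ → M.D} (h : ∀ n < k, ρ n = ρ' n) : t.eval M ρ = t.eval M ρ' := by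
  induction t with
  | var n => exact h n ht
  | const c => rfl
  | func f ts ih => simp only [Term.eval, fun i => ih i (ht i)]

theorem vcons_congr {α : Type*} {k : ℕ} {ρ ρ' : ℕ → α} (h : ∀ n < k, ρ n = ρ' n) (d : α) :
    ∀ n < k + 1, vcons d ρ n = vcons d ρ' n := by
  rintro (_ | n) hn
  · rfl
  · exact h n (by omega)

theorem sat_congr (M : KModel.{u} L) {φ : Formula L} {k : ℕ} (hφ : φ.ClosedAt k) (w : M.W)
    {ρ ρ' : ℕ → M.D} (h : ∀ n < k, ρ n = ρ' n) : Sat M w ρ φ ↔ Sat M w ρ' φ := by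
  induction φ generalizing w ρ ρ' k with
  | top => rfl
  | bot => rfl
  | rel R ts => simp only [Sat, fun i => Term.eval_congr M (hφ i) h]
  | and φ ψ ihφ ihψ | or φ ψ ihφ ihψ | imp φ ψ ihφ ihψ =>
    simp only [Sat, fun w => ihφ hφ.1 w h, fun w => ihψ hφ.2 w h]
  | all φ ih => exact forall_congr' fun d => ih hφ w (vcons_congr h d)
  | ex φ ih => exact exists_congr fun d => ih hφ w (vcons_congr h d)

theorem sat_vcons_of_sentence (M : KModel.{u} L) {φ : Formula L} (hφ : φ.Sentence) (w : M.W)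
    (ρ : ℕ → M.D) (d : M.D) : Sat M w (vcons d ρ) φ ↔ Sat M w ρ φ := by
  have h : ∀ n < 0, vcons d ρ n = ρ n := fun n hn => absurd hn (Nat.not_lt_zero n)
  exact sat_congr M hφ w h

theorem KModel.Proper.sat_mono {M : KModel.{u} L} (hM : M.Proper) {φ : Formula L} {w v : M.W}
    (hwv : M.acc w v) {ρ : ℕ → M.D} (h : Sat M w ρ φ) : Sat M v ρ φ := by
  induction φ generalizing ρ with
  | top => trivial
  | bot => exact h
  | rel R ts => exact hM.2.2.2 R w v hwv h
  | and φ ψ ihφ ihψ => exact ⟨ihφ h.1, ihψ h.2⟩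
  | or φ ψ ihφ ihψ => exact h.imp ihφ ihψ
  | imp φ ψ => exact fun x hvx => h x (hM.2.2.1 hwv hvx)
  | all φ ih => exact fun d => ih (h d)
  | ex φ ih => exact h.imp fun d => ih

open Classical in
/-- Reinterpret the constant `c` as `d`. -/
noncomputable def KModel.updateConst (M : KModel.{u} L) (c : L.Const) (d : M.D) :
    KModel.{u} L where
  W := M.W
  acc := M.acc
  D := M.D
  interpC := Function.update M.interpC c d
  interpF := M.interpF
  interpR := M.interpR

theorem KModel.updateConst_interpC_self (M : KModel.{u} L) (c : L.Const) (d : M.D) :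
    (M.updateConst c d).interpC c = d := by
  classical
  exact Function.update_self c d M.interpC

theorem Term.eval_updateConst (M : KModel.{u} L) {c : L.Const} (d : M.D) {t : Term L}
    (ht : ¬ t.OccC c) (ρ : ℕ → M.D) : t.eval (M.updateConst c d) ρ = t.eval M ρ := by
  induction t with
  | var n => rfl
  | const e =>
    classical
    exact Function.update_of_ne ht _ _
  | func f ts ih =>
    exact congrArg (M.interpF f) (funext fun i => ih i fun hi => ht ⟨i, hi⟩)

theorem sat_updateConst (M : KModel.{u} L) {c : L.Const} (d : M.D) {φ : Formula L}
    (hφ : ¬ φ.OccC c) (w : M.W) (ρ : ℕ → M.D) :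
    Sat (M.updateConst c d) w ρ φ ↔ Sat M w ρ φ := by
  induction φ generalizing w ρ with
  | top => rfl
  | bot => rfl
  | rel R ts =>
    have h : (fun i => (ts i).eval (M.updateConst c d) ρ) = fun i => (ts i).eval M ρ :=
      funext fun i => Term.eval_updateConst M d (fun hi => hφ ⟨i, hi⟩) ρ
    exact iff_of_eq (congrArg (· ∈ M.interpR R w) h)
  | and φ ψ ihφ ihψ =>
    exact and_congr (ihφ (fun h => hφ (.inl h)) w ρ) (ihψ (fun h => hφ (.inr h)) w ρ)
  | or φ ψ ihφ ihψ =>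
    exact or_congr (ihφ (fun h => hφ (.inl h)) w ρ) (ihψ (fun h => hφ (.inr h)) w ρ)
  | imp φ ψ ihφ ihψ =>
    exact forall_congr' fun v => forall_congr' fun _ =>
      imp_congr (ihφ (fun h => hφ (.inl h)) v ρ) (ihψ (fun h => hφ (.inr h)) v ρ)
  | all φ ih => exact forall_congr' fun e => ih hφ w (vcons e ρ)
  | ex φ ih => exact exists_congr fun e => ih hφ w (vcons e ρ)

theorem sat_subst0_aconst_updateConst (M : KModel.{u} L.plus) {i : ℕ} (d : M.D)
    {φ : Formula L.plus} (hφ : ¬ φ.OccC (Sum.inr i)) (w : M.W) (ρ : ℕ → M.D) :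
    Sat (M.updateConst (Sum.inr i) d) w ρ (subst0 φ (aconst L i)) ↔ Sat M w (vcons d ρ) φ := by
  have h : (aconst L i).eval (M.updateConst (Sum.inr i) d) ρ = d :=
    M.updateConst_interpC_self (Sum.inr i) d
  refine (sat_subst0 (M.updateConst (Sum.inr i) d) φ (aconst L i) w ρ).trans ?_
  exact (congrArg (fun e => Sat (M.updateConst (Sum.inr i) d) w (vcons e ρ) φ) h).to_iff.trans
    (sat_updateConst M d hφ w (vcons d ρ))

theorem FreshIn.sat_updateConst {Γ : Set (Formula L.plus)} {i : ℕ} (hi : FreshIn i Γ)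
    (M : KModel.{u} L.plus) (d : M.D) {w : M.W} {ρ : ℕ → M.D} (h : ∀ ψ ∈ Γ, Sat M w ρ ψ) :
    ∀ ψ ∈ Γ, Sat (M.updateConst (Sum.inr i) d) w ρ ψ :=
  fun ψ hψ => (BQL.sat_updateConst M d (hi ψ hψ) w ρ).2 (h ψ hψ)

/-- Soundness relative to a fixed valuation, which does not need the assumptions to be
sentences. -/
theorem Prf.sat {Γ Δ : Set (Formula L.plus)} {φ : Formula L.plus} (h : Prf L Γ Δ φ)
    (M : KModel.{u} L.plus) (hM : M.Proper) {w v : M.W} (hww : M.acc w w) (hwv : M.acc w v)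
    (ρ : ℕ → M.D) (hΓ : ∀ ψ ∈ Γ, Sat M w ρ ψ) (hΔ : ∀ ψ ∈ Δ, Sat M v ρ ψ) : Sat M v ρ φ := by
  induction h generalizing M with
  | hyp h _ => exact h.elim (fun h => hM.sat_mono hwv (hΓ _ h)) (hΔ _)
  | weaken hsΓ hsΔ _ ih =>
    exact ih M hM hww hwv ρ (fun ψ h => hΓ ψ (hsΓ h)) (fun ψ h => hΔ ψ (hsΔ h))
  | topIntro => trivial
  | botElim _ _ ih => exact (ih M hM hww hwv ρ hΓ hΔ).elim
  | andIntro _ _ ih₁ ih₂ => exact ⟨ih₁ M hM hww hwv ρ hΓ hΔ, ih₂ M hM hww hwv ρ hΓ hΔ⟩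
  | andElimL _ ih => exact (ih M hM hww hwv ρ hΓ hΔ).1
  | andElimR _ ih => exact (ih M hM hww hwv ρ hΓ hΔ).2
  | orIntroL _ _ ih => exact .inl (ih M hM hww hwv ρ hΓ hΔ)
  | orIntroR _ _ ih => exact .inr (ih M hM hww hwv ρ hΓ hΔ)
  | orElim _ _ _ ih ih₁ ih₂ =>
    rcases ih M hM hww hwv ρ hΓ hΔ with h | h
    · exact ih₁ M hM hww hwv ρ hΓ (Set.forall_mem_insert.2 ⟨h, hΔ⟩)
    · exact ih₂ M hM hww hwv ρ hΓ (Set.forall_mem_insert.2 ⟨h, hΔ⟩)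
  | impIntro _ _ ih =>
    intro x hvx h
    exact ih M hM hww (hM.2.2.1 hwv hvx) ρ hΓ
      (Set.forall_mem_insert.2 ⟨h, fun ψ hψ => hM.sat_mono hvx (hΔ ψ hψ)⟩)
  | impElim _ _ ih₁ ih₂ =>
    exact ih₂ M hM hww hww ρ hΓ (fun _ h => h.elim) v hwv (ih₁ M hM hww hwv ρ hΓ hΔ)
  | intTrans _ _ ih₁ ih₂ =>
    exact fun x hvx h => ih₂ M hM hww hwv ρ hΓ hΔ x hvx (ih₁ M hM hww hwv ρ hΓ hΔ x hvx h)
  | intAndIntro _ _ ih₁ ih₂ =>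
    exact fun x hvx h =>
      ⟨ih₁ M hM hww hwv ρ hΓ hΔ x hvx h, ih₂ M hM hww hwv ρ hΓ hΔ x hvx h⟩
  | intOrElim _ _ ih₁ ih₂ =>
    exact fun x hvx h =>
      h.elim (ih₁ M hM hww hwv ρ hΓ hΔ x hvx) (ih₂ M hM hww hwv ρ hΓ hΔ x hvx)
  | intAllIntro hφ _ ih =>
    exact fun x hvx h d =>
      ih M hM hww hwv ρ hΓ hΔ d x hvx ((sat_vcons_of_sentence M hφ x ρ d).2 h)
  | intExElim hψ _ ih =>
    rintro x hvx ⟨d, h⟩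
    exact (sat_vcons_of_sentence M hψ x ρ d).1 (ih M hM hww hwv ρ hΓ hΔ d x hvx h)
  | allIntro hsΓ hsΔ hfΓ hfΔ hφ _ ih =>
    intro d
    exact (sat_subst0_aconst_updateConst M d hφ v ρ).1 <|
      ih (M.updateConst _ d) hM hww hwv ρ
        (hfΓ.sat_updateConst M d fun ψ h => hΓ ψ (hsΓ h))
        (hfΔ.sat_updateConst M d fun ψ h => hΔ ψ (hsΔ h))
  | allElim _ _ ih => exact (sat_subst0 M _ _ v ρ).2 (ih M hM hww hwv ρ hΓ hΔ _)
  | cd hφ _ ih =>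
    by_contra hn
    refine hn (.inr fun d => (ih M hM hww hwv ρ hΓ hΔ d).resolve_left fun h => hn (.inl ?_))
    exact (sat_vcons_of_sentence M hφ v ρ d).1 h
  | exIntro _ _ _ ih => exact ⟨_, (sat_subst0 M _ _ v ρ).1 (ih M hM hww hwv ρ hΓ hΔ)⟩
  | exElim hsΓ hsΔ hfΓ hfΔ hφ hψ _ _ ih₁ ih₂ =>
    obtain ⟨d, h⟩ := ih₁ M hM hww hwv ρ hΓ hΔ
    exact (sat_updateConst M d hψ v ρ).1 <|
      ih₂ (M.updateConst _ d) hM hww hwv ρ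
        (hfΓ.sat_updateConst M d fun ψ h => hΓ ψ (hsΓ h))
        (Set.forall_mem_insert.2 ⟨(sat_subst0_aconst_updateConst M d hφ v ρ).2 h,
          hfΔ.sat_updateConst M d fun ψ h => hΔ ψ (hsΔ h)⟩)

/-- **Generalized Soundness** (Lemma 10): if `Γ : Δ ⊢ φ` then `Γ : Δ ⊨ φ`. -/
theorem generalized_soundness {L : Signature} (Γ Δ : Set (Formula L.plus))
    (φ : Formula L.plus) (hΓ : ∀ ψ ∈ Γ, Formula.Sentence ψ)
    (hΔ : ∀ ψ ∈ Δ, Formula.Sentence ψ) (hφ : φ.Sentence)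
    (h : Prf L Γ Δ φ) : ModelsCtx.{u} Γ Δ φ :=
  fun M hM _ _ hww hwv hwΓ hvΔ ρ =>
    h.sat M hM hww hwv ρ (fun ψ hψ => hwΓ ψ hψ ρ) (fun ψ hψ => hvΔ ψ hψ ρ)

end BQL
end

section
/- Disjunction Property: For any set Γ of L-sentences containing no occurrence of ∨ and no occurrence of ∃, and any L-sentences φ, ψ: if Γ ⊨ φ∨ψ then Γ ⊨ φ or Γ ⊨ ψ. -/
universe u v

namespace BQL

variable {L : Signature}

theorem comp_vcons {α β : Type*} (g : α → β) (d : α) (ρ : ℕ → α) :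
    g ∘ vcons d ρ = vcons (g d) (g ∘ ρ) := by
  funext n
  cases n <;> rfl

/-- Satisfaction is persistent along the accessibility relation of a proper model. -/
theorem Sat.mono {M : KModel.{u} L} (hM : M.Proper) {w v : M.W} (hwv : M.acc w v)
    {ρ : ℕ → M.D} {φ : Formula L} (h : Sat M w ρ φ) : Sat M v ρ φ := by
  obtain ⟨-, -, htrans, hpers⟩ := hM
  induction φ generalizing ρ with
  | top => trivial
  | bot => exact h
  | rel R ts => exact hpers R w v hwv h
  | and φ ψ ihφ ihψ => exact ⟨ihφ h.1, ihψ h.2⟩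
  | or φ ψ ihφ ihψ => exact h.imp ihφ ihψ
  | imp φ ψ _ _ => exact fun x hx => h x (htrans hwv hx)
  | all φ ih => exact fun d => ih (h d)
  | ex φ ih =>
    obtain ⟨d, hd⟩ := h
    exact ⟨d, ih hd⟩

/-- A bounded morphism `f` of frames from `N` to `M`, paired with a surjective strong homomorphism
`g` from the domain of `M` to that of `N`. -/
structure KModel.BoundedMorphism (N M : KModel.{u} L) (f : N.W → M.W) (g : M.D → N.D) :
    Prop where
  surjective : Function.Surjective g
  map_const : ∀ c, g (M.interpC c) = N.interpC c
  map_func : ∀ F ts, g (M.interpF F ts) = N.interpF F (g ∘ ts)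
  map_rel : ∀ R w ts, ts ∈ M.interpR R (f w) ↔ g ∘ ts ∈ N.interpR R w
  acc_iff : ∀ w v, M.acc (f w) v ↔ ∃ x, N.acc w x ∧ f x = v

namespace KModel.BoundedMorphism

variable {N M : KModel.{u} L} {f : N.W → M.W} {g : M.D → N.D}

theorem map_eval (h : BoundedMorphism N M f g) (ρ : ℕ → M.D) (t : Term L) :
    g (t.eval M ρ) = t.eval N (g ∘ ρ) := by
  induction t with
  | var n => rfl
  | const c => exact h.map_const c
  | func F ts ih =>
    simp only [Term.eval, h.map_func]
    exact congrArg _ (funext ih)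

theorem sat_iff (h : BoundedMorphism N M f g) (w : N.W) (ρ : ℕ → M.D) (φ : Formula L) :
    Sat M (f w) ρ φ ↔ Sat N w (g ∘ ρ) φ := by
  induction φ generalizing w ρ with
  | top => rfl
  | bot => rfl
  | rel R ts =>
    simp only [Sat, h.map_rel]
    rw [show g ∘ (fun i => (ts i).eval M ρ) = fun i => (ts i).eval N (g ∘ ρ) from
      funext fun i => h.map_eval ρ (ts i)]
  | and φ ψ ihφ ihψ => exact and_congr (ihφ w ρ) (ihψ w ρ)
  | or φ ψ ihφ ihψ => exact or_congr (ihφ w ρ) (ihψ w ρ)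
  | imp φ ψ ihφ ihψ =>
    simp only [Sat, h.acc_iff]
    constructor
    · intro H x hx hφ
      exact (ihψ x ρ).1 (H (f x) ⟨x, hx, rfl⟩ ((ihφ x ρ).2 hφ))
    · rintro H _ ⟨x, hx, rfl⟩ hφ
      exact (ihψ x ρ).2 (H x hx ((ihφ x ρ).1 hφ))
  | all φ ih => simp only [Sat, ih, comp_vcons, h.surjective.forall]
  | ex φ ih => simp only [Sat, ih, comp_vcons, h.surjective.exists]

end KModel.BoundedMorphism

namespace KModel

/-- The model obtained from `M` and `N`, over the product of their domains, by adding below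
`w` and `v` a reflexive root at which an atom holds iff it holds at both `w` and `v`. -/
def glue (M N : KModel.{u} L) (w : M.W) (v : N.W) : KModel.{u} L where
  W := Option (M.W ⊕ N.W)
  acc
    | none, none => True
    | none, some (.inl x) => M.acc w x
    | none, some (.inr y) => N.acc v y
    | some (.inl x), some (.inl x') => M.acc x x'
    | some (.inr y), some (.inr y') => N.acc y y'
    | _, _ => False
  D := M.D × N.D
  interpC c := (M.interpC c, N.interpC c)
  interpF F ts := (M.interpF F (Prod.fst ∘ ts), N.interpF F (Prod.snd ∘ ts))
  interpR R
    | none => {ts | Prod.fst ∘ ts ∈ M.interpR R w ∧ Prod.snd ∘ ts ∈ N.interpR R v}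
    | some (.inl x) => {ts | Prod.fst ∘ ts ∈ M.interpR R x}
    | some (.inr y) => {ts | Prod.snd ∘ ts ∈ N.interpR R y}

variable {M N : KModel.{u} L} {w : M.W} {v : N.W}

theorem Proper.glue (hM : M.Proper) (hN : N.Proper) : (M.glue N w v).Proper := by
  obtain ⟨-, ⟨d⟩, htM, hpM⟩ := hM
  obtain ⟨-, ⟨e⟩, htN, hpN⟩ := hN
  refine ⟨⟨none⟩, ⟨(d, e)⟩, ?_, ?_⟩
  · rintro (_ | x | x) (_ | y | y) (_ | z | z) hxy hyz <;>
      first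
      | trivial
      | exact hxy.elim
      | exact hyz.elim
      | exact hyz
      | exact htM hxy hyz
      | exact htN hxy hyz
  · rintro R (_ | x | x) (_ | y | y) hxy ts hts <;>
      first
      | exact hxy.elim
      | exact hts
      | exact hpM R _ _ hxy hts
      | exact hpN R _ _ hxy hts
      | exact hpM R _ _ hxy hts.1
      | exact hpN R _ _ hxy hts.2

theorem boundedMorphism_glue_inl [Nonempty N.D] :
    BoundedMorphism M (M.glue N w v) (fun x => some (.inl x)) Prod.fst where
  surjective := Prod.fst_surjective
  map_const _ := rfl
  map_func _ _ := rfl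
  map_rel _ _ _ := Iff.rfl
  acc_iff x y := by rcases y with (_ | y | y) <;> simp [glue]

theorem boundedMorphism_glue_inr [Nonempty M.D] :
    BoundedMorphism N (M.glue N w v) (fun y => some (.inr y)) Prod.snd where
  surjective := Prod.snd_surjective
  map_const _ := rfl
  map_func _ _ := rfl
  map_rel _ _ _ := Iff.rfl
  acc_iff x y := by rcases y with (_ | y | y) <;> simp [glue]

theorem sat_fst_of_sat_root (hM : M.Proper) (hN : N.Proper) (hw : M.acc w w)
    {ρ : ℕ → M.D × N.D} {φ : Formula L} (h : Sat (M.glue N w v) none ρ φ) :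
    Sat M w (Prod.fst ∘ ρ) φ :=
  have := hN.2.1
  (boundedMorphism_glue_inl.sat_iff w ρ φ).1
    (Sat.mono (hM.glue hN) (show (M.glue N w v).acc none (some (.inl w)) from hw) h)

theorem sat_snd_of_sat_root (hM : M.Proper) (hN : N.Proper) (hv : N.acc v v)
    {ρ : ℕ → M.D × N.D} {φ : Formula L} (h : Sat (M.glue N w v) none ρ φ) :
    Sat N v (Prod.snd ∘ ρ) φ :=
  have := hM.2.1
  (boundedMorphism_glue_inr.sat_iff v ρ φ).1
    (Sat.mono (hM.glue hN) (show (M.glue N w v).acc none (some (.inr v)) from hv) h)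

/-- A formula without `∨` and `∃` holds at the root of a glued model as soon as it holds at both
of the worlds above which the models were glued. -/
theorem sat_root_of_noOrEx (hM : M.Proper) (hN : N.Proper) (hw : M.acc w w) (hv : N.acc v v)
    {ρ : ℕ → M.D × N.D} {φ : Formula L} (hφ : φ.NoOrEx)
    (h₁ : Sat M w (Prod.fst ∘ ρ) φ) (h₂ : Sat N v (Prod.snd ∘ ρ) φ) :
    Sat (M.glue N w v) none ρ φ := by
  have := hM.2.1
  have := hN.2.1
  have hl := boundedMorphism_glue_inl (M := M) (N := N) (w := w) (v := v)
  have hr := boundedMorphism_glue_inr (M := M) (N := N) (w := w) (v := v)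
  induction φ generalizing ρ with
  | top => trivial
  | bot => exact h₁
  | rel R ts => exact ⟨(hl.sat_iff w ρ (.rel R ts)).2 h₁, (hr.sat_iff v ρ (.rel R ts)).2 h₂⟩
  | and φ ψ ihφ ihψ => exact ⟨ihφ hφ.1 h₁.1 h₂.1, ihψ hφ.2 h₁.2 h₂.2⟩
  | or φ ψ => exact hφ.elim
  | imp φ ψ _ ihψ =>
    rintro (_ | x | y) hacc h
    · exact ihψ hφ.2 (h₁ w hw (sat_fst_of_sat_root hM hN hw h))
        (h₂ v hv (sat_snd_of_sat_root hM hN hv h))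
    · exact (hl.sat_iff x ρ ψ).2 (h₁ x hacc ((hl.sat_iff x ρ φ).1 h))
    · exact (hr.sat_iff y ρ ψ).2 (h₂ y hacc ((hr.sat_iff y ρ φ).1 h))
  | all φ ih =>
    rintro (d : M.D × N.D)
    refine ih (ρ := vcons d ρ) hφ ?_ ?_
    · rw [comp_vcons]
      exact h₁ d.1
    · rw [comp_vcons]
      exact h₂ d.2
  | ex φ => exact hφ.elim

end KModel

/-- **Disjunction Property** (Theorem 18): for `Γ ⊆ L \ {∨, ∃}`: if `Γ ⊨ φ ∨ ψ`
then `Γ ⊨ φ` or `Γ ⊨ ψ`. -/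
theorem disjunction_property {L : Signature} (Γ : Set (Formula L)) (φ ψ : Formula L)
    (hΓ : ∀ χ ∈ Γ, Formula.Sentence χ ∧ Formula.NoOrEx χ)
    (hφ : φ.Sentence) (hψ : ψ.Sentence)
    (h : Models.{u} Γ (.or φ ψ)) : Models.{u} Γ φ ∨ Models.{u} Γ ψ := by
  by_contra! hcon
  obtain ⟨h₁, h₂⟩ := hcon
  simp only [Models, SatS, not_forall] at h₁ h₂
  obtain ⟨M, hM, w, hw, hΓM, ρ₁, hnφ⟩ := h₁
  obtain ⟨N, hN, v, hv, hΓN, ρ₂, hnψ⟩ := h₂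
  rcases h (M.glue N w v) (hM.glue hN) none trivial
      (fun χ hχ ρ => KModel.sat_root_of_noOrEx hM hN hw hv (hΓ χ hχ).2 (hΓM χ hχ _) (hΓN χ hχ _))
      (fun n => (ρ₁ n, ρ₂ n)) with hroot | hroot
  · exact hnφ (KModel.sat_fst_of_sat_root hM hN hw hroot)
  · exact hnψ (KModel.sat_snd_of_sat_root hM hN hv hroot)

end BQL
end
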